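/- arXiv:0911.4772 — 3 statements merged into one kernel-verified Lean document; each statement's English description precedes it below -/
import Mathlib

section
/- Let x0, y0, rho be real numbers and let A be the 6×6 real matrix whose rows are (1, 1/2, 1/2, 0, 0, 0), (1−y0, 0, (1−y0²)/2, y0, 0, y0²/2), (1−x0, (1−x0²)/2, 0, x0, x0²/2, 0), (−1, −x0, 0, 1, x0, 0), (−1, 0, −y0, 1, 0, y0), (0, −y0, −x0, 0, rho·y0, rho·x0). Then det(A) = (1/4)·(x0² + y0²)·(rho·(x0·y0 − 1) − x0·y0). -/
open Matrix

set_option maxHeartbeats 4000000 in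
theorem det_interface_matrix (x0 y0 rho : ℝ) :
    Matrix.det !![(1 : ℝ), 1/2, 1/2, 0, 0, 0;
      1 - y0, 0, (1 - y0^2)/2, y0, 0, y0^2/2;
      1 - x0, (1 - x0^2)/2, 0, x0, x0^2/2, 0;
      -1, -x0, 0, 1, x0, 0;
      -1, 0, -y0, 1, 0, y0;
      0, -y0, -x0, 0, rho * y0, rho * x0] =
    (1/4) * (x0^2 + y0^2) * (rho * (x0 * y0 - 1) - x0 * y0) := by
  simp [Matrix.det_succ_row_zero, Fin.sum_univ_succ, Fin.succAbove]
  ring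
end

section
/- Let x0, y0, rho be real numbers with 0 < x0 ≤ 1, 0 < y0 ≤ 1 and rho > 0. Then for any real numbers V1, V2, V3 there exists a unique tuple (a0, b0, c0, a1, b1, c1) of real numbers satisfying the six linear equations: (i) a0 + b0/2 + c0/2 = V1; (ii) (a1 + (y0/2)·c1)·y0 + (a0 + ((y0+1)/2)·c0)·(1−y0) = V2; (iii) (a1 + (x0/2)·b1)·x0 + (a0 + ((x0+1)/2)·b0)·(1−x0) = V3; (iv) a0 + b0·x0 = a1 + b1·x0; (v) a0 + c0·y0 = a1 + c1·y0; (vi) b0·y0 + c0·x0 = rho·(b1·y0 + c1·x0). -/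
theorem broken_P1_existence_uniqueness (x0 y0 rho : ℝ)
    (hx0 : 0 < x0) (hx1 : x0 ≤ 1) (hy0 : 0 < y0) (hy1 : y0 ≤ 1) (hrho : 0 < rho)
    (V1 V2 V3 : ℝ) :
    ∃! v : ℝ × ℝ × ℝ × ℝ × ℝ × ℝ,
      let (a0, b0, c0, a1, b1, c1) := v
      a0 + b0/2 + c0/2 = V1 ∧
      (a1 + (y0/2) * c1) * y0 + (a0 + ((y0 + 1)/2) * c0) * (1 - y0) = V2 ∧
      (a1 + (x0/2) * b1) * x0 + (a0 + ((x0 + 1)/2) * b0) * (1 - x0) = V3 ∧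
      a0 + b0 * x0 = a1 + b1 * x0 ∧
      a0 + c0 * y0 = a1 + c1 * y0 ∧
      b0 * y0 + c0 * x0 = rho * (b1 * y0 + c1 * x0) := by
  have hxy : x0 * y0 ≤ 1 := by nlinarith
  have hD : 0 < (x0 ^ 2 + y0 ^ 2) * (x0 * y0 + rho * (1 - x0 * y0)) := by
    have h1 : 0 < x0 * y0 := mul_pos hx0 hy0
    have h2 : 0 ≤ rho * (1 - x0 * y0) := mul_nonneg hrho.le (by linarith)
    have h3 : 0 < x0 ^ 2 + y0 ^ 2 := by positivity
    exact mul_pos h3 (by linarith)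
  -- the jump: the lower piece minus the upper piece is `s * (x0 * y0 - y0 * x - x0 * y)`
  obtain ⟨s, hs⟩ : ∃ s : ℝ, s * ((x0 ^ 2 + y0 ^ 2) * (x0 * y0 + rho * (1 - x0 * y0)))
      = (rho - 1) * (2 * (V1 - V2) * y0 + 2 * (V1 - V3) * x0) :=
    ⟨_, div_mul_cancel₀ _ hD.ne'⟩
  refine ⟨(V2 + V3 - V1 - s * x0 * y0 * (x0 + y0) / 2,
    2 * (V1 - V2) + s * x0 * y0 * y0, 2 * (V1 - V3) + s * x0 * y0 * x0,
    V2 + V3 - V1 - s * x0 * y0 * (x0 + y0) / 2 + s * (x0 * y0),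
    2 * (V1 - V2) + s * x0 * y0 * y0 - s * y0,
    2 * (V1 - V3) + s * x0 * y0 * x0 - s * x0), ?_, ?_⟩
  · refine ⟨by ring, by ring, by ring, by ring, by ring, ?_⟩
    linear_combination hs
  · rintro ⟨a0, b0, c0, a1, b1, c1⟩ ⟨h1, h2, h3, h4, h5, h6⟩
    obtain ⟨r, hr⟩ : ∃ r : ℝ, r * (x0 * y0) = a1 - a0 :=
      ⟨_, div_mul_cancel₀ _ (mul_pos hx0 hy0).ne'⟩
    have ha1 : a1 = a0 + r * (x0 * y0) := by linarith
    have hb1 : b1 = b0 - r * y0 := by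
      apply mul_right_cancel₀ hx0.ne'
      linear_combination -h4 - ha1
    have hc1 : c1 = c0 - r * x0 := by
      apply mul_right_cancel₀ hy0.ne'
      linear_combination -h5 - ha1
    subst ha1 hb1 hc1
    have hb : b0 = 2 * (V1 - V2) + r * x0 * y0 * y0 := by
      linear_combination 2 * h1 - 2 * h2
    have hc : c0 = 2 * (V1 - V3) + r * x0 * y0 * x0 := by
      linear_combination 2 * h1 - 2 * h3
    have ha : a0 = V2 + V3 - V1 - r * x0 * y0 * (x0 + y0) / 2 := by
      linear_combination h1 - hb / 2 - hc / 2
    subst hb hc ha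
    have hrs : r = s := by
      apply mul_right_cancel₀ hD.ne'
      linear_combination h6 - hs
    subst hrs
    rfl
end

section
/- Let x0, y0, rho be real numbers with 0 < x0 ≤ 1, 0 < y0 ≤ 1 and rho > 0, and let V be any real number. Then the unique tuple (a0, b0, c0, a1, b1, c1) of real numbers satisfying the six linear equations (i) a0 + b0/2 + c0/2 = V; (ii) (a1 + (y0/2)·c1)·y0 + (a0 + ((y0+1)/2)·c0)·(1−y0) = V; (iii) (a1 + (x0/2)·b1)·x0 + (a0 + ((x0+1)/2)·b0)·(1−x0) = V; (iv) a0 + b0·x0 = a1 + b1·x0; (v) a0 + c0·y0 = a1 + c1·y0; (vi) b0·y0 + c0·x0 = rho·(b1·y0 + c1·x0) is (a0, b0, c0, a1, b1, c1) = (V, 0, 0, V, 0, 0). In other words, if the three edge averages of the broken piecewise linear function are equal, the function is the constant V. -/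
theorem broken_P1_equal_averages_constant (x0 y0 rho : ℝ)
    (hx0 : 0 < x0) (hx1 : x0 ≤ 1) (hy0 : 0 < y0) (hy1 : y0 ≤ 1) (hrho : 0 < rho)
    (V : ℝ) (a0 b0 c0 a1 b1 c1 : ℝ) :
    (a0 + b0/2 + c0/2 = V ∧
      (a1 + (y0/2) * c1) * y0 + (a0 + ((y0 + 1)/2) * c0) * (1 - y0) = V ∧
      (a1 + (x0/2) * b1) * x0 + (a0 + ((x0 + 1)/2) * b0) * (1 - x0) = V ∧
      a0 + b0 * x0 = a1 + b1 * x0 ∧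
      a0 + c0 * y0 = a1 + c1 * y0 ∧
      b0 * y0 + c0 * x0 = rho * (b1 * y0 + c1 * x0)) ↔
    (a0 = V ∧ b0 = 0 ∧ c0 = 0 ∧ a1 = V ∧ b1 = 0 ∧ c1 = 0) := by
  constructor
  · rintro ⟨h1, h2, h3, h4, h5, h6⟩
    have e1 : b1 * x0 = b0 * x0 - (a1 - a0) := by linarith
    have e2 : c1 * y0 = c0 * y0 - (a1 - a0) := by linarith
    have k2 : a0 + y0 * (a1 - a0) / 2 + c0 / 2 = V := by
      linear_combination h2 - y0 / 2 * e2
    have k3 : a0 + x0 * (a1 - a0) / 2 + b0 / 2 = V := by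
      linear_combination h3 - x0 / 2 * e1
    have hb : b0 = y0 * (a1 - a0) := by linarith
    have hc : c0 = x0 * (a1 - a0) := by linarith
    have hxy : 0 < x0 * y0 := mul_pos hx0 hy0
    have hxy1 : x0 * y0 ≤ 1 := by nlinarith
    have hpos : 0 < (x0 ^ 2 + y0 ^ 2) * (x0 * y0 + rho * (1 - x0 * y0)) := by
      have : 0 ≤ rho * (1 - x0 * y0) := mul_nonneg hrho.le (by linarith)
      positivity
    have key : (a1 - a0) * ((x0 ^ 2 + y0 ^ 2) * (x0 * y0 + rho * (1 - x0 * y0))) = 0 := by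
      rw [hb] at e1 h6
      rw [hc] at e2 h6
      linear_combination x0 * y0 * h6 + rho * y0 ^ 2 * e1 + rho * x0 ^ 2 * e2
    have hd : a1 - a0 = 0 := (mul_eq_zero.mp key).resolve_right hpos.ne'
    rw [hd] at hb hc e1 e2
    have hb0 : b0 = 0 := by linarith
    have hc0 : c0 = 0 := by linarith
    subst hb0 hc0
    have hb1 : b1 = 0 := (mul_eq_zero.mp (by linarith : b1 * x0 = 0)).resolve_right hx0.ne'
    have hc1 : c1 = 0 := (mul_eq_zero.mp (by linarith : c1 * y0 = 0)).resolve_right hy0.ne'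
    exact ⟨by linarith, rfl, rfl, by linarith, hb1, hc1⟩
  · rintro ⟨rfl, rfl, rfl, rfl, rfl, rfl⟩
    refine ⟨?_, ?_, ?_, ?_, ?_, ?_⟩ <;> ring
end
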